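/- Let a, b ∈ ℍ with ‖a‖² + ‖b‖² = 1, let t = Re(a) with |t| < 1, and suppose b ≠ 0. Let V = {(x, y, z) ∈ ℍ³ : Re(x) = 0, Re(z) = 0, Re( conj(Im(a))·x ) + Re( conj(b)·y ) = 0 }. Then a real number λ admits a nonzero solution (x, y, z) ∈ V of the system t·x = λ·√(1−t²)·x, t·y + b·z = λ·√(1−t²)·y, Im( conj(b)·y ) = λ·√(1−t²)·z, if and only if λ ∈ { t/√(1−t²), (t + √(t² + 4‖b‖²))/(2√(1−t²)), (t − √(t² + 4‖b‖²))/(2√(1−t²)) }; these three values are pairwise distinct, and for each of them the real vector space of solutions (x, y, z) ∈ V has dimension 3. (These are the principal curvatures, each of multiplicity 3, of the isoparametric hypersurface F⁻¹(t) ⊂ Sp(2) at a point with first row (a, b).) -/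

import Mathlib

noncomputable section
open Matrix

/-- The real quaternions. -/
abbrev H : Type := Quaternion ℝ

/-- The solutions in `V` of the eigenvalue system, in terms of `μ = λ √(1 - t²)`. -/
def eigenSolutions (a b : H) (μ : ℝ) : Set (H × H × H) :=
  {p | (p.1.re = 0 ∧ p.2.2.re = 0 ∧ (star a.im * p.1).re + (star b * p.2.1).re = 0) ∧
    a.re • p.1 = μ • p.1 ∧ a.re • p.2.1 + b * p.2.2 = μ • p.2.1 ∧
    (star b * p.2.1).im = μ • p.2.2}

/-- The linear parametrization of the eigenspace for `μ = t` by the first coordinate. -/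
def fstParam (a b : H) : H →ₗ[ℝ] H × H × H where
  toFun v := (v, (-(star a.im * v).re / ‖b‖ ^ 2) • b, 0)
  map_add' u v := by
    simp only [mul_add, Quaternion.re_add, Prod.mk_add_mk, ← add_smul, add_zero]
    congr 3
    ring
  map_smul' c v := by
    simp only [mul_smul_comm, Quaternion.re_smul, Prod.smul_mk, smul_smul, smul_zero,
      RingHom.id_apply, smul_eq_mul]
    congr 3
    ring

/-- The linear parametrization of the eigenspaces for `μ ≠ t` by the last coordinate. -/
def lastParam (b : H) (r : ℝ) : H →ₗ[ℝ] H × H × H where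
  toFun v := (0, r • (b * v), v)
  map_add' u v := by simp [mul_add]
  map_smul' c v := by simp [smul_comm r c]

lemma star_mul_self_eq_coe_norm_sq (b : H) : star b * b = ((‖b‖ ^ 2 : ℝ) : H) := by
  rw [Quaternion.star_mul_self, Quaternion.normSq_eq_norm_mul_self, ← sq]

lemma star_mul_smul_mul (b v : H) (r : ℝ) :
    star b * (r • (b * v)) = (r * ‖b‖ ^ 2) • v := by
  rw [mul_smul_comm, ← mul_assoc, star_mul_self_eq_coe_norm_sq, Quaternion.coe_mul_eq_smul,
    smul_smul]

lemma Quaternion.im_eq_self_of_re_eq_zero {v : H} (hv : v.re = 0) : v.im = v := by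
  ext <;> simp [hv]

lemma exists_basis_imaginary : ∃ i j k : H, i.re = 0 ∧ j.re = 0 ∧ k.re = 0 ∧
    (∀ x y z : ℝ, x • i + y • j + z • k = 0 → x = 0 ∧ y = 0 ∧ z = 0) ∧
    ∀ v : H, v.re = 0 → ∃ x y z : ℝ, x • i + y • j + z • k = v := by
  have mk (x y z : ℝ) : ∃ q : H, q.re = 0 ∧ q.imI = x ∧ q.imJ = y ∧ q.imK = z :=
    ⟨⟨0, x, y, z⟩, rfl, rfl, rfl, rfl⟩
  obtain ⟨i, hi, hiI, hiJ, hiK⟩ := mk 1 0 0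
  obtain ⟨j, hj, hjI, hjJ, hjK⟩ := mk 0 1 0
  obtain ⟨k, hk, hkI, hkJ, hkK⟩ := mk 0 0 1
  refine ⟨i, j, k, hi, hj, hk, fun x y z h => ?_, fun v hv => ⟨v.imI, v.imJ, v.imK, ?_⟩⟩
  · have hI := congrArg (fun q : H => q.imI) h
    have hJ := congrArg (fun q : H => q.imJ) h
    have hK := congrArg (fun q : H => q.imK) h
    simp only [Quaternion.imI_add, Quaternion.imJ_add, Quaternion.imK_add, Quaternion.imI_smul,
      Quaternion.imJ_smul, Quaternion.imK_smul, Quaternion.imI_zero, Quaternion.imJ_zero,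
      Quaternion.imK_zero, hiI, hiJ, hiK, hjI, hjJ, hjK, hkI, hkJ, hkK, smul_eq_mul, mul_zero,
      mul_one, add_zero, zero_add] at hI hJ hK
    exact ⟨hI, hJ, hK⟩
  · apply Quaternion.ext <;>
      simp [hv, hi, hj, hk, hiI, hiJ, hiK, hjI, hjJ, hjK, hkI, hkJ, hkK]

lemma exists_three_of_eq_image {S : Set (H × H × H)} (f : H →ₗ[ℝ] H × H × H)
    (g : H × H × H →ₗ[ℝ] H) (hgf : ∀ v, g (f v) = v)
    (hS : ∀ p, p ∈ S ↔ ∃ v : H, v.re = 0 ∧ f v = p) :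
    ∃ p₁ p₂ p₃ : H × H × H, LinearIndependent ℝ ![p₁, p₂, p₃] ∧
      ({p₁, p₂, p₃} : Set (H × H × H)) ⊆ S ∧
      S ⊆ (Submodule.span ℝ {p₁, p₂, p₃} : Submodule ℝ (H × H × H)) := by
  obtain ⟨i, j, k, hi, hj, hk, hli, hspan⟩ := exists_basis_imaginary
  refine ⟨f i, f j, f k, ?_, ?_, ?_⟩
  · rw [Fintype.linearIndependent_iff]
    intro c hc
    have h := congrArg g hc
    simp only [Fin.sum_univ_three, map_add, map_smul, map_zero, Matrix.cons_val, hgf] at h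
    obtain ⟨h₀, h₁, h₂⟩ := hli _ _ _ h
    intro l
    fin_cases l <;> assumption
  · rintro p (rfl | rfl | rfl)
    exacts [(hS _).2 ⟨i, hi, rfl⟩, (hS _).2 ⟨j, hj, rfl⟩, (hS _).2 ⟨k, hk, rfl⟩]
  · intro p hp
    obtain ⟨v, hv, rfl⟩ := (hS p).1 hp
    obtain ⟨x, y, z, rfl⟩ := hspan v hv
    exact Submodule.mem_span_triple.2 ⟨x, y, z, by simp only [map_add, map_smul]⟩

lemma mem_eigenSolutions_re_iff {a b : H} (hb : b ≠ 0) (p : H × H × H) :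
    p ∈ eigenSolutions a b a.re ↔ ∃ v : H, v.re = 0 ∧ fstParam a b v = p := by
  have hβ : ‖b‖ ^ 2 ≠ 0 := by simpa using hb
  obtain ⟨x, y, z⟩ := p
  simp only [eigenSolutions, Set.mem_ofPred_eq, fstParam, LinearMap.coe_mk, AddHom.coe_mk,
    Prod.mk.injEq]
  constructor
  · rintro ⟨⟨hx, -, hxy⟩, -, hy, hz⟩
    have hz0 : z = 0 := by simpa [hb] using hy
    subst hz0
    refine ⟨x, hx, rfl, ?_, rfl⟩
    have hby : star b * y = ((star b * y).re : H) := by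
      rw [smul_zero] at hz
      conv_lhs => rw [← Quaternion.re_add_im (star b * y), hz, add_zero]
    apply mul_left_cancel₀ (star_ne_zero.2 hb)
    rw [mul_smul_comm, star_mul_self_eq_coe_norm_sq, Quaternion.smul_coe, div_mul_cancel₀ _ hβ, hby,
      eq_neg_of_add_eq_zero_right hxy]
  · rintro ⟨v, hv, rfl, rfl, rfl⟩
    have h : star b * ((-(star a.im * v).re / ‖b‖ ^ 2) • b) = ((-(star a.im * v).re : ℝ) : H) := by
      rw [mul_smul_comm, star_mul_self_eq_coe_norm_sq, Quaternion.smul_coe, div_mul_cancel₀ _ hβ]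
    refine ⟨⟨hv, Quaternion.re_zero, ?_⟩, trivial, ?_, ?_⟩
    · rw [h, Quaternion.re_coe, add_neg_cancel]
    · rw [mul_zero, add_zero]
    · rw [h, Quaternion.im_coe, smul_zero]

lemma eq_lastParam_of_mem_eigenSolutions {a b : H} {μ : ℝ} (hμ : μ ≠ a.re) {p : H × H × H}
    (hp : p ∈ eigenSolutions a b μ) :
    p.2.2.re = 0 ∧ lastParam b (μ - a.re)⁻¹ p.2.2 = p := by
  have hd : μ - a.re ≠ 0 := sub_ne_zero.2 hμ
  obtain ⟨x, y, z⟩ := p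
  obtain ⟨⟨-, hz, -⟩, hx, hy, -⟩ := hp
  dsimp only at hz hx hy
  have hx0 : x = 0 := by
    have : (μ - a.re) • x = 0 := by rw [sub_smul, hx, sub_self]
    exact (smul_eq_zero.1 this).resolve_left hd
  have hbz : b * z = (μ - a.re) • y := by rw [sub_smul, ← hy, add_sub_cancel_left]
  refine ⟨hz, ?_⟩
  simp only [lastParam, LinearMap.coe_mk, AddHom.coe_mk, hx0, hbz, inv_smul_smul₀ hd]

lemma quadratic_of_mem_eigenSolutions {a b : H} {μ : ℝ} (hμ : μ ≠ a.re) {p : H × H × H}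
    (hp : p ∈ eigenSolutions a b μ) (hp0 : p ≠ 0) : μ * (μ - a.re) = ‖b‖ ^ 2 := by
  have hd : μ - a.re ≠ 0 := sub_ne_zero.2 hμ
  obtain ⟨hz, hpz⟩ := eq_lastParam_of_mem_eigenSolutions hμ hp
  have hz0 : p.2.2 ≠ 0 := fun h => hp0 (by rw [← hpz, h, map_zero])
  have hy : p.2.1 = (μ - a.re)⁻¹ • (b * p.2.2) := (congrArg (fun q => q.2.1) hpz).symm
  have h := hp.2.2.2
  rw [hy, star_mul_smul_mul, Quaternion.im_smul,
    Quaternion.im_eq_self_of_re_eq_zero hz] at h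
  have h' := smul_left_injective ℝ hz0 h
  field_simp at h'
  exact h'.symm

lemma mem_eigenSolutions_iff {a b : H} {μ : ℝ} (hμ : μ ≠ a.re)
    (h : μ * (μ - a.re) = ‖b‖ ^ 2) (p : H × H × H) :
    p ∈ eigenSolutions a b μ ↔
      ∃ v : H, v.re = 0 ∧ lastParam b (μ - a.re)⁻¹ v = p := by
  have hd : μ - a.re ≠ 0 := sub_ne_zero.2 hμ
  refine ⟨fun hp => ⟨_, eq_lastParam_of_mem_eigenSolutions hμ hp⟩, ?_⟩
  rintro ⟨v, hv, rfl⟩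
  have hβ : (μ - a.re)⁻¹ * ‖b‖ ^ 2 = μ := by rw [← h]; field_simp
  simp only [eigenSolutions, Set.mem_ofPred_eq, lastParam, LinearMap.coe_mk, AddHom.coe_mk,
    star_mul_smul_mul, hβ, Quaternion.re_smul, Quaternion.im_smul, hv,
    Quaternion.im_eq_self_of_re_eq_zero hv]
  refine ⟨⟨Quaternion.re_zero, trivial, ?_⟩, by simp, ?_, trivial⟩
  · rw [mul_zero, smul_zero, add_zero, Quaternion.re_zero]
  · rw [eq_comm, ← sub_eq_iff_eq_add', ← sub_smul, smul_inv_smul₀ hd]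

/-- The solutions for `μ = t`, or for a root `μ` of `μ (μ - t) = ‖b‖²`, form a real vector space
of dimension three. -/
lemma exists_three_eigenSolutions {a b : H} (hb : b ≠ 0) {μ : ℝ}
    (h : μ = a.re ∨ μ * (μ - a.re) = ‖b‖ ^ 2) :
    ∃ p₁ p₂ p₃ : H × H × H, LinearIndependent ℝ ![p₁, p₂, p₃] ∧
      ({p₁, p₂, p₃} : Set (H × H × H)) ⊆ eigenSolutions a b μ ∧
      eigenSolutions a b μ ⊆
        (Submodule.span ℝ {p₁, p₂, p₃} : Submodule ℝ (H × H × H)) := by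
  by_cases hμ : μ = a.re
  · subst hμ
    exact exists_three_of_eq_image (fstParam a b) (LinearMap.fst ℝ H (H × H)) (fun _ => rfl)
      (mem_eigenSolutions_re_iff hb)
  · exact exists_three_of_eq_image (lastParam b (μ - a.re)⁻¹)
      (LinearMap.snd ℝ H H ∘ₗ LinearMap.snd ℝ H (H × H)) (fun _ => rfl)
      (mem_eigenSolutions_iff hμ (h.resolve_left hμ))

lemma exists_ne_zero_mem_eigenSolutions_iff {a b : H} (hb : b ≠ 0) (μ : ℝ) :
    (∃ p ∈ eigenSolutions a b μ, p ≠ 0) ↔ μ = a.re ∨ μ * (μ - a.re) = ‖b‖ ^ 2 := by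
  constructor
  · rintro ⟨p, hp, hp0⟩
    by_cases hμ : μ = a.re
    · exact Or.inl hμ
    · exact Or.inr (quadratic_of_mem_eigenSolutions hμ hp hp0)
  · intro h
    obtain ⟨p₁, p₂, p₃, hli, hsub, -⟩ := exists_three_eigenSolutions hb h
    exact ⟨p₁, hsub (by simp), hli.ne_zero 0⟩

lemma quadratic_iff {s t β : ℝ} (hs : s ≠ 0) (hβ : 0 ≤ β) (lam : ℝ) :
    lam * s * (lam * s - t) = β ↔
      lam = (t + √(t ^ 2 + 4 * β)) / (2 * s) ∨ lam = (t - √(t ^ 2 + 4 * β)) / (2 * s) := by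
  have hD : √(t ^ 2 + 4 * β) ^ 2 = t ^ 2 + 4 * β := Real.sq_sqrt (by positivity)
  have h2s : 2 * s ≠ 0 := mul_ne_zero two_ne_zero hs
  rw [eq_div_iff h2s, eq_div_iff h2s]
  constructor
  · intro h
    have : (lam * (2 * s) - (t + √(t ^ 2 + 4 * β))) *
        (lam * (2 * s) - (t - √(t ^ 2 + 4 * β))) = 0 := by linear_combination 4 * h - hD
    exact (mul_eq_zero.1 this).imp sub_eq_zero.1 sub_eq_zero.1
  · rintro (h | h)
    · linear_combination (lam * s / 2 - t / 4 + √(t ^ 2 + 4 * β) / 4) * h + hD / 4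
    · linear_combination (lam * s / 2 - t / 4 - √(t ^ 2 + 4 * β) / 4) * h + hD / 4

/-- The shape operator of the isoparametric hypersurface
`F⁻¹(t) ⊂ Sp(2)` (`F(Q) = Re Q₀₀`) at a point with first row `(a, b)`,
`b ≠ 0`, has exactly the three eigenvalues
`t/√(1−t²)`, `(t ± √(t² + 4‖b‖²))/(2√(1−t²))`, each with multiplicity 3:
a real `λ` admits a nonzero solution `(x,y,z)` in the tangent space `V` of the
eigenvalue system iff it is one of these three pairwise distinct values, and
for each of them the real space of solutions has dimension 3 (it contains
three linearly independent solutions which span all solutions). -/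
theorem principal_curvatures_of_level_hypersurfaces
    (a b : H) (hab : ‖a‖ ^ 2 + ‖b‖ ^ 2 = 1) (hb : b ≠ 0) (ht : |a.re| < 1) :
    let t : ℝ := a.re
    let s : ℝ := Real.sqrt (1 - t ^ 2)
    -- the tangent space of `F⁻¹(t)` at `Q` in left-invariant coordinates
    let V : Set (H × H × H) := {p | p.1.re = 0 ∧ p.2.2.re = 0 ∧
      (star a.im * p.1).re + (star b * p.2.1).re = 0}
    -- the eigenvalue system of the shape operator
    let Sol : ℝ → Set (H × H × H) := fun lam =>
      {p | p ∈ V ∧ t • p.1 = (lam * s) • p.1 ∧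
        t • p.2.1 + b * p.2.2 = (lam * s) • p.2.1 ∧
        (star b * p.2.1).im = (lam * s) • p.2.2}
    let lam₁ : ℝ := t / s
    let lam₂ : ℝ := (t + Real.sqrt (t ^ 2 + 4 * ‖b‖ ^ 2)) / (2 * s)
    let lam₃ : ℝ := (t - Real.sqrt (t ^ 2 + 4 * ‖b‖ ^ 2)) / (2 * s)
    (∀ lam : ℝ,
        (∃ p ∈ Sol lam, p ≠ 0) ↔ lam = lam₁ ∨ lam = lam₂ ∨ lam = lam₃) ∧
    (lam₁ ≠ lam₂ ∧ lam₁ ≠ lam₃ ∧ lam₂ ≠ lam₃) ∧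
    (∀ lam : ℝ, lam = lam₁ ∨ lam = lam₂ ∨ lam = lam₃ →
      ∃ p₁ p₂ p₃ : H × H × H, LinearIndependent ℝ ![p₁, p₂, p₃] ∧
        ({p₁, p₂, p₃} : Set (H × H × H)) ⊆ Sol lam ∧
        Sol lam ⊆ (Submodule.span ℝ {p₁, p₂, p₃} : Submodule ℝ (H × H × H))) := by
  intro t s V Sol lam₁ lam₂ lam₃
  have ht' : 0 < 1 - t ^ 2 := sub_pos.2 ((sq_lt_one_iff_abs_lt_one t).2 ht)
  have hs : s ≠ 0 := (Real.sqrt_pos.2 ht').ne'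
  have hβ : 0 < ‖b‖ ^ 2 := by positivity
  have hD : √(t ^ 2 + 4 * ‖b‖ ^ 2) ^ 2 = t ^ 2 + 4 * ‖b‖ ^ 2 := Real.sq_sqrt (by positivity)
  have h2s : 2 * s ≠ 0 := mul_ne_zero two_ne_zero hs
  have key (lam : ℝ) : (lam * s = t ∨ lam * s * (lam * s - t) = ‖b‖ ^ 2) ↔
      lam = lam₁ ∨ lam = lam₂ ∨ lam = lam₃ := by
    rw [quadratic_iff hs hβ.le, ← eq_div_iff hs]
  refine ⟨fun lam => (exists_ne_zero_mem_eigenSolutions_iff hb (lam * s)).trans (key lam),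
    ⟨fun h => ?_, fun h => ?_, fun h => ?_⟩,
    fun lam h => exists_three_eigenSolutions hb ((key lam).2 h)⟩
  · rw [div_eq_div_iff hs h2s] at h
    have h' : √(t ^ 2 + 4 * ‖b‖ ^ 2) = t := mul_left_cancel₀ hs (by linear_combination -h)
    rw [h'] at hD
    linarith
  · rw [div_eq_div_iff hs h2s] at h
    have h' : √(t ^ 2 + 4 * ‖b‖ ^ 2) = -t := mul_left_cancel₀ hs (by linear_combination h)
    rw [h'] at hD
    linarith [neg_sq t]
  · rw [div_left_inj' h2s] at h
    have h' : √(t ^ 2 + 4 * ‖b‖ ^ 2) = 0 := by linarith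
    rw [h'] at hD
    linarith [sq_nonneg t]
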